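/- One-round code yields a Markov structure: Let M₁, M₂ and the pair (X¹, X²) be mutually independent finite-valued random variables (X¹, X² may themselves be tuples), and let C, Ŷ¹, Ŷ² be finite-valued random variables with H(C | X¹, M₁) = 0, H(Ŷ¹ | X¹, M₁) = 0, and H(Ŷ² | C, M₂, X²) = 0. Then I(Ŷ²; X¹, Ŷ¹, M₁ | C, X²) = 0; in particular the Markov chain Ŷ² – (C, X²) – (X¹, Ŷ¹) holds. -/

import Mathlib

open scoped BigOperators
open Finset

noncomputable section

namespace Coord

variable {Ω α β γ : Type*}

/-- `p` is a probability mass function on the finite type `α`. -/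
def IsPMF [Fintype α] (p : α → ℝ) : Prop := (∀ a, 0 ≤ p a) ∧ ∑ a, p a = 1

/-- ℓ¹ (total variation) distance between two functions on a finite type. -/
def l1dist [Fintype α] (p q : α → ℝ) : ℝ := ∑ a, |p a - q a|

/-- The distribution (pushforward pmf) of the random variable `X` defined on the
finite sample space `Ω` carrying the pmf `μ`. -/
def distr [Fintype Ω] [DecidableEq α] (μ : Ω → ℝ) (X : Ω → α) : α → ℝ :=
  fun a => ∑ ω, if X ω = a then μ ω else 0

/-- Shannon entropy (base 2) of a pmf. -/
def entFun [Fintype α] (p : α → ℝ) : ℝ := - ∑ a, p a * Real.logb 2 (p a)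

/-- Shannon entropy `H(X)` of a random variable `X` on `(Ω, μ)`. -/
def H [Fintype Ω] [Fintype α] [DecidableEq α] (μ : Ω → ℝ) (X : Ω → α) : ℝ :=
  entFun (distr μ X)

/-- Conditional entropy `H(X | Z)`. -/
def condEnt [Fintype Ω] [Fintype α] [Fintype γ] [DecidableEq α] [DecidableEq γ]
    (μ : Ω → ℝ) (X : Ω → α) (Z : Ω → γ) : ℝ :=
  H μ (fun ω => (X ω, Z ω)) - H μ Z

/-- Mutual information `I(X; Y)`. -/
def mi [Fintype Ω] [Fintype α] [Fintype β] [DecidableEq α] [DecidableEq β]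
    (μ : Ω → ℝ) (X : Ω → α) (Y : Ω → β) : ℝ :=
  H μ X + H μ Y - H μ (fun ω => (X ω, Y ω))

/-- Conditional mutual information `I(X; Y | Z)`. -/
def cmi [Fintype Ω] [Fintype α] [Fintype β] [Fintype γ]
    [DecidableEq α] [DecidableEq β] [DecidableEq γ]
    (μ : Ω → ℝ) (X : Ω → α) (Y : Ω → β) (Z : Ω → γ) : ℝ :=
  H μ (fun ω => (X ω, Z ω)) + H μ (fun ω => (Y ω, Z ω))
    - H μ (fun ω => (X ω, Y ω, Z ω)) - H μ Z

theorem distr_nonneg [Fintype Ω] [DecidableEq α] {μ : Ω → ℝ} (hμ : IsPMF μ) (X : Ω → α) (a : α) :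
    0 ≤ distr μ X a :=
  Finset.sum_nonneg fun ω _ => by split_ifs <;> simp [hμ.1 ω]

theorem distr_pos [Fintype Ω] [DecidableEq α] {μ : Ω → ℝ} (hμ : IsPMF μ) (X : Ω → α) {ω : Ω}
    (hω : 0 < μ ω) : 0 < distr μ X (X ω) := by
  refine Finset.sum_pos' (fun ω' _ => ?_) ⟨ω, Finset.mem_univ ω, by simpa using hω⟩
  split_ifs <;> simp [hμ.1 ω']

/-- Law of the unconscious statistician. -/
theorem sum_distr_mul [Fintype Ω] [Fintype α] [DecidableEq α] (μ : Ω → ℝ) (X : Ω → α)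
    (g : α → ℝ) : ∑ a, distr μ X a * g a = ∑ ω, μ ω * g (X ω) := by
  simp only [distr, Finset.sum_mul]
  rw [Finset.sum_comm]
  simp [ite_mul]

theorem sum_distr [Fintype Ω] [Fintype α] [DecidableEq α] {μ : Ω → ℝ} (hμ : IsPMF μ)
    (X : Ω → α) : ∑ a, distr μ X a = 1 := by
  simpa [hμ.2] using sum_distr_mul μ X fun _ => 1

theorem sum_distr_pair [Fintype Ω] [Fintype α] [DecidableEq α] [DecidableEq γ] (μ : Ω → ℝ)
    (X : Ω → α) (Z : Ω → γ) (c : γ) :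
    ∑ a, distr μ (fun ω => (X ω, Z ω)) (a, c) = distr μ Z c := by
  simp only [distr, Prod.mk.injEq]
  rw [Finset.sum_comm]
  refine Finset.sum_congr rfl fun ω _ => ?_
  by_cases h : Z ω = c <;> simp [h]

theorem H_eq_sum [Fintype Ω] [Fintype α] [DecidableEq α] (μ : Ω → ℝ) (X : Ω → α) :
    H μ X = -∑ ω, μ ω * Real.logb 2 (distr μ X (X ω)) := by
  rw [H, entFun, sum_distr_mul μ X fun a => Real.logb 2 (distr μ X a)]

/-- A function of `X` has at most the entropy of `X`. -/
theorem H_le_H [Fintype Ω] [Fintype α] [Fintype β] [DecidableEq α] [DecidableEq β]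
    {μ : Ω → ℝ} (hμ : IsPMF μ) {X : Ω → α} {Y : Ω → β}
    (h : ∀ ω ω', X ω = X ω' → Y ω = Y ω') : H μ Y ≤ H μ X := by
  rw [H_eq_sum, H_eq_sum, neg_le_neg_iff]
  refine Finset.sum_le_sum fun ω _ => ?_
  rcases (hμ.1 ω).eq_or_lt with h0 | hpos
  · simp [← h0]
  · refine mul_le_mul_of_nonneg_left
      (Real.logb_le_logb_of_le one_lt_two (distr_pos hμ X hpos) ?_) hpos.le
    refine Finset.sum_le_sum fun ω' _ => ?_
    by_cases hX : X ω' = X ω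
    · simp [hX, h _ _ hX]
    · rw [if_neg hX]
      split_ifs <;> simp [hμ.1 ω']

theorem sum_distr_mul_distr_div_le_one [Fintype Ω] [Fintype α] [Fintype β] [Fintype γ]
    [DecidableEq α] [DecidableEq β] [DecidableEq γ] {μ : Ω → ℝ} (hμ : IsPMF μ)
    (X : Ω → α) (Y : Ω → β) (Z : Ω → γ) :
    ∑ w : α × β × γ, distr μ (fun ω => (X ω, Z ω)) (w.1, w.2.2) *
      distr μ (fun ω => (Y ω, Z ω)) (w.2.1, w.2.2) / distr μ Z w.2.2 ≤ 1 := by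
  rw [← sum_distr hμ Z, Fintype.sum_prod_type]
  simp only [Fintype.sum_prod_type]
  rw [Finset.sum_congr rfl fun a _ => Finset.sum_comm, Finset.sum_comm]
  refine Finset.sum_le_sum fun c _ => le_of_eq ?_
  simp only [← Finset.sum_div, ← Finset.mul_sum, ← Finset.sum_mul, sum_distr_pair]
  exact mul_self_div_self _

theorem cmi_nonneg [Fintype Ω] [Fintype α] [Fintype β] [Fintype γ]
    [DecidableEq α] [DecidableEq β] [DecidableEq γ] {μ : Ω → ℝ} (hμ : IsPMF μ)
    (X : Ω → α) (Y : Ω → β) (Z : Ω → γ) : 0 ≤ cmi μ X Y Z := by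
  set XZ := fun ω => (X ω, Z ω)
  set YZ := fun ω => (Y ω, Z ω)
  set W := fun ω => (X ω, Y ω, Z ω)
  let r : α × β × γ → ℝ := fun w => distr μ XZ (w.1, w.2.2) * distr μ YZ (w.2.1, w.2.2) /
    distr μ Z w.2.2
  have hr : ∀ w, 0 ≤ r w := fun w =>
    div_nonneg (mul_nonneg (distr_nonneg hμ _ _) (distr_nonneg hμ _ _)) (distr_nonneg hμ _ _)
  have hsum : ∑ ω, μ ω * (r (W ω) / distr μ W (W ω)) ≤ 1 := by
    rw [← sum_distr_mul μ W fun w => r w / distr μ W w]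
    refine (Finset.sum_le_sum fun w _ => ?_).trans (sum_distr_mul_distr_div_le_one hμ X Y Z)
    rcases eq_or_ne (distr μ W w) 0 with h0 | h0
    · simpa [h0] using hr w
    · exact (mul_div_cancel₀ (r w) h0).le
  have hlog : ∀ ω, μ ω * (1 - r (W ω) / distr μ W (W ω)) ≤
      (μ ω * Real.logb 2 (distr μ W (W ω)) + μ ω * Real.logb 2 (distr μ Z (Z ω))
        - μ ω * Real.logb 2 (distr μ XZ (XZ ω)) - μ ω * Real.logb 2 (distr μ YZ (YZ ω)))
        * Real.log 2 := by
    intro ω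
    rcases (hμ.1 ω).eq_or_lt with h0 | hpos
    · simp [← h0]
    have hW := distr_pos hμ W hpos
    have hZ := distr_pos hμ Z hpos
    have hXZ := distr_pos hμ XZ hpos
    have hYZ := distr_pos hμ YZ hpos
    have hrω : r (W ω) = distr μ XZ (XZ ω) * distr μ YZ (YZ ω) / distr μ Z (Z ω) := rfl
    have hle := Real.log_le_sub_one_of_pos
      (div_pos (div_pos (mul_pos hXZ hYZ) hZ) hW)
    rw [Real.log_div (by positivity) hW.ne', Real.log_div (by positivity) hZ.ne',
      Real.log_mul hXZ.ne' hYZ.ne', ← hrω] at hle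
    have h2 : Real.log 2 ≠ 0 := (Real.log_pos one_lt_two).ne'
    have hcancel : ∀ t, Real.logb 2 t * Real.log 2 = Real.log t := fun t =>
      div_mul_cancel₀ _ h2
    have hmul := mul_le_mul_of_nonneg_left hle hpos.le
    simp only [sub_mul, add_mul, mul_assoc, hcancel]
    linarith
  have htotal := Finset.sum_le_sum fun ω (_ : ω ∈ Finset.univ) => hlog ω
  simp only [← Finset.sum_mul, mul_sub, mul_one, Finset.sum_sub_distrib, Finset.sum_add_distrib,
    hμ.2] at htotal
  have hnonneg := nonneg_of_mul_nonneg_left ((sub_nonneg.2 hsum).trans htotal)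
    (Real.log_pos one_lt_two)
  rw [cmi, H_eq_sum, H_eq_sum, H_eq_sum, H_eq_sum]
  linarith

/-- Submodularity of entropy, for `W` a function of each of `U`, `V`, and `J` a function of
`(U, V)`. -/
theorem H_add_H_le {δ : Type*} [Fintype Ω] [Fintype α] [Fintype β] [Fintype γ] [Fintype δ]
    [DecidableEq α] [DecidableEq β] [DecidableEq γ] [DecidableEq δ] {μ : Ω → ℝ} (hμ : IsPMF μ)
    {U : Ω → α} {V : Ω → β} {W : Ω → γ} {J : Ω → δ}
    (hU : ∀ ω ω', U ω = U ω' → W ω = W ω') (hV : ∀ ω ω', V ω = V ω' → W ω = W ω')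
    (hJ : ∀ ω ω', U ω = U ω' → V ω = V ω' → J ω = J ω') :
    H μ J + H μ W ≤ H μ U + H μ V := by
  have h := cmi_nonneg hμ U V W
  have h₁ : H μ (fun ω => (U ω, W ω)) ≤ H μ U := H_le_H hμ (by grind)
  have h₂ : H μ (fun ω => (V ω, W ω)) ≤ H μ V := H_le_H hμ (by grind)
  have h₃ : H μ J ≤ H μ (fun ω => (U ω, V ω, W ω)) := H_le_H hμ (by grind)
  rw [cmi] at h
  linarith

theorem H_const [Fintype Ω] [Fintype α] [DecidableEq α] {μ : Ω → ℝ} (hμ : IsPMF μ) (a : α) :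
    H μ (fun _ => a) = 0 := by
  simp [H_eq_sum, distr, hμ.2]

/-- Subadditivity of entropy. -/
theorem H_pair_le [Fintype Ω] [Fintype α] [Fintype β] [DecidableEq α] [DecidableEq β]
    {μ : Ω → ℝ} (hμ : IsPMF μ) (X : Ω → α) (Y : Ω → β) :
    H μ (fun ω => (X ω, Y ω)) ≤ H μ X + H μ Y := by
  have h := H_add_H_le hμ (U := X) (V := Y) (W := fun _ => ()) (J := fun ω => (X ω, Y ω))
    (by simp) (by simp) (by grind)
  rwa [H_const hμ, add_zero] at h

theorem H_triple_of_indep [Fintype Ω] [Fintype α] [Fintype β] [Fintype γ]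
    [DecidableEq α] [DecidableEq β] [DecidableEq γ] {μ : Ω → ℝ} (hμ : IsPMF μ)
    {X : Ω → α} {Y : Ω → β} {Z : Ω → γ}
    (h : distr μ (fun ω => (X ω, Y ω, Z ω)) =
      fun w => distr μ X w.1 * distr μ Y w.2.1 * distr μ Z w.2.2) :
    H μ (fun ω => (X ω, Y ω, Z ω)) = H μ X + H μ Y + H μ Z := by
  simp only [H_eq_sum, h, ← neg_add, ← Finset.sum_add_distrib]
  refine congrArg _ (Finset.sum_congr rfl fun ω _ => ?_)
  rcases (hμ.1 ω).eq_or_lt with h0 | hpos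
  · simp [← h0]
  have hX := (distr_pos hμ X hpos).ne'
  have hY := (distr_pos hμ Y hpos).ne'
  rw [Real.logb_mul (mul_ne_zero hX hY) (distr_pos hμ Z hpos).ne', Real.logb_mul hX hY]
  ring

/-- one-round code yields a Markov structure. Let `M₁, M₂` and the
pair `(X¹, X²)` be mutually independent, and let `C, Ŷ¹, Ŷ²` satisfy
`H(C | X¹, M₁) = 0`, `H(Ŷ¹ | X¹, M₁) = 0` and `H(Ŷ² | C, M₂, X²) = 0`. Then
`I(Ŷ²; X¹, Ŷ¹, M₁ | C, X²) = 0`; in particular the Markov chain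
`Ŷ² – (C, X²) – (X¹, Ŷ¹)` holds. -/
theorem one_round_markov_structure
    {Ω 𝓜₁ 𝓜₂ 𝒳₁ 𝒳₂ 𝓒 𝒴₁ 𝒴₂ : Type}
    [Fintype Ω] [DecidableEq Ω]
    [Fintype 𝓜₁] [DecidableEq 𝓜₁] [Fintype 𝓜₂] [DecidableEq 𝓜₂]
    [Fintype 𝒳₁] [DecidableEq 𝒳₁] [Fintype 𝒳₂] [DecidableEq 𝒳₂]
    [Fintype 𝓒] [DecidableEq 𝓒]
    [Fintype 𝒴₁] [DecidableEq 𝒴₁] [Fintype 𝒴₂] [DecidableEq 𝒴₂]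
    (μ : Ω → ℝ) (hμ : IsPMF μ)
    (M₁ : Ω → 𝓜₁) (M₂ : Ω → 𝓜₂) (X₁ : Ω → 𝒳₁) (X₂ : Ω → 𝒳₂)
    (C : Ω → 𝓒) (Y₁ : Ω → 𝒴₁) (Y₂ : Ω → 𝒴₂)
    -- M₁, M₂, (X¹, X²) mutually independent
    (hind : distr μ (fun ω => (M₁ ω, M₂ ω, X₁ ω, X₂ ω)) =
      fun m => distr μ M₁ m.1 * distr μ M₂ m.2.1 *
        distr μ (fun ω => (X₁ ω, X₂ ω)) m.2.2)
    (hC : condEnt μ C (fun ω => (X₁ ω, M₁ ω)) = 0)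
    (hY₁ : condEnt μ Y₁ (fun ω => (X₁ ω, M₁ ω)) = 0)
    (hY₂ : condEnt μ Y₂ (fun ω => (C ω, M₂ ω, X₂ ω)) = 0) :
    cmi μ Y₂ (fun ω => (X₁ ω, Y₁ ω, M₁ ω)) (fun ω => (C ω, X₂ ω)) = 0 ∧
    cmi μ Y₂ (fun ω => (X₁ ω, Y₁ ω)) (fun ω => (C ω, X₂ ω)) = 0 := by
  have hM₂ : H μ (fun ω => (M₂ ω, C ω, X₂ ω)) ≤ H μ M₂ + H μ (fun ω => (C ω, X₂ ω)) :=
    H_pair_le hμ M₂ _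
  have hM₁ : H μ (fun ω => (M₁ ω, X₁ ω, X₂ ω)) ≤ H μ M₁ + H μ (fun ω => (X₁ ω, X₂ ω)) :=
    H_pair_le hμ M₁ _
  have hindep := H_triple_of_indep hμ hind
  have hdropY₁ : H μ (fun ω => (M₁ ω, X₁ ω, Y₁ ω, X₂ ω)) + H μ (fun ω => (X₁ ω, M₁ ω)) ≤
      H μ (fun ω => (Y₁ ω, X₁ ω, M₁ ω)) + H μ (fun ω => (M₁ ω, X₁ ω, X₂ ω)) :=
    H_add_H_le hμ (by grind) (by grind) (by grind)
  have hdropC : H μ (fun ω => ((X₁ ω, Y₁ ω, M₁ ω), C ω, X₂ ω)) + H μ (fun ω => (X₁ ω, M₁ ω)) ≤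
      H μ (fun ω => (C ω, X₁ ω, M₁ ω)) + H μ (fun ω => (M₁ ω, X₁ ω, Y₁ ω, X₂ ω)) :=
    H_add_H_le hμ (by grind) (by grind) (by grind)
  have hadjoinM₂ : H μ (fun ω => (M₁ ω, M₂ ω, X₁ ω, X₂ ω)) +
      H μ (fun ω => (Y₂ ω, C ω, X₂ ω)) ≤
      H μ (fun ω => (Y₂ ω, C ω, M₂ ω, X₂ ω)) +
      H μ (fun ω => (Y₂ ω, (X₁ ω, Y₁ ω, M₁ ω), C ω, X₂ ω)) :=
    H_add_H_le hμ (by grind) (by grind) (by grind)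
  have hperm : H μ (fun ω => (C ω, M₂ ω, X₂ ω)) ≤ H μ (fun ω => (M₂ ω, C ω, X₂ ω)) :=
    H_le_H hμ (by grind)
  have hdropM₁ : H μ (fun ω => (Y₂ ω, (X₁ ω, Y₁ ω, M₁ ω), C ω, X₂ ω)) +
      H μ (fun ω => ((X₁ ω, Y₁ ω), C ω, X₂ ω)) ≤
      H μ (fun ω => (Y₂ ω, (X₁ ω, Y₁ ω), C ω, X₂ ω)) +
      H μ (fun ω => ((X₁ ω, Y₁ ω, M₁ ω), C ω, X₂ ω)) :=
    H_add_H_le hμ (by grind) (by grind) (by grind)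
  have h₁ := cmi_nonneg hμ Y₂ (fun ω => (X₁ ω, Y₁ ω, M₁ ω)) (fun ω => (C ω, X₂ ω))
  have h₂ := cmi_nonneg hμ Y₂ (fun ω => (X₁ ω, Y₁ ω)) (fun ω => (C ω, X₂ ω))
  unfold condEnt at hC hY₁ hY₂
  unfold cmi at h₁ h₂ ⊢
  constructor <;> linarith

end Coord
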